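/- arXiv:1710.01071 — 2 statements merged into one kernel-verified Lean document; each statement's English description precedes it below -/
import Mathlib

section
/- Let m be a positive even integer. The number of matrices [[x, y], [0, z]] with xz = m, 0 ≤ y < z, gcd(x, y, z) = 1 and z odd, plus the number of matrices [[x, y], [0, z]] with xz = 2m, 0 ≤ y < z, gcd(x, y, z) = 1 and both x and z even, equals the number of matrices [[x, y], [0, z]] with xz = m, 0 ≤ y < z, gcd(x, y, z) = 1 and x odd. Writing m = 2^a·b with b odd, all these counts equal 2^a·ψ(b). -/
/-- The Dedekind psi function `ψ(n) = n · ∏_{p | n, p prime} (1 + 1/p)`. -/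
def dedekindPsi (n : ℕ) : ℕ :=
  (n / n.primeFactors.prod id) * n.primeFactors.prod (fun p => p + 1)

namespace CountM

/-- number of admissible `y` for a given diagonal `(x, z)` -/
def F (x z : ℕ) : ℕ := ((Finset.range z).filter (fun y => Nat.gcd (Nat.gcd x y) z = 1)).card

lemma count_mul_period (g k : ℕ) : Nat.count (Nat.Coprime g) (g * k) = k * Nat.totient g := by
  induction k with
  | zero => simp
  | succ k ih =>
    rw [Nat.mul_succ, Nat.count_add, ih]
    have : (fun j => Nat.Coprime g (g * k + j)) = Nat.Coprime g := by
      funext j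
      simp
    simp only [this]
    rw [Nat.totient_eq_card_coprime, Nat.count_eq_card_filter_range]
    ring

lemma F_eq (x z : ℕ) (hz : 0 < z) : F x z = z / Nat.gcd x z * Nat.totient (Nat.gcd x z) := by
  rw [← count_mul_period, Nat.mul_div_cancel' (Nat.gcd_dvd_right x z),
    Nat.count_eq_card_filter_range, F]
  congr 1
  ext y
  simp only [Finset.mem_filter, Nat.Coprime]
  rw [Nat.gcd_assoc, Nat.gcd_comm y z, ← Nat.gcd_assoc]

lemma F_mul {x z x' z' : ℕ} (hz : 0 < z) (hz' : 0 < z') (h : Nat.Coprime (x * z) (x' * z')) :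
    F (x * x') (z * z') = F x z * F x' z' := by
  have h1 : Nat.Coprime x x' := h.coprime_mul_right.coprime_mul_right_right
  have h2 : Nat.Coprime x z' := h.coprime_mul_right.coprime_mul_left_right
  have h3 : Nat.Coprime z x' := h.coprime_mul_left.coprime_mul_right_right
  have h4 : Nat.Coprime z z' := h.coprime_mul_left.coprime_mul_left_right
  have hg : Nat.gcd (x * x') (z * z') = Nat.gcd x z * Nat.gcd x' z' := by
    rw [h4.gcd_mul, h3.symm.gcd_mul_right_cancel, h2.gcd_mul_left_cancel]
  have hc : Nat.Coprime (Nat.gcd x z) (Nat.gcd x' z') :=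
    (h1.coprime_dvd_left (Nat.gcd_dvd_left _ _)).coprime_dvd_right (Nat.gcd_dvd_left _ _)
  rw [F_eq _ _ (by positivity), F_eq _ _ hz, F_eq _ _ hz', hg, Nat.totient_mul hc,
    Nat.mul_div_mul_comm (Nat.gcd_dvd_right _ _) (Nat.gcd_dvd_right _ _)]
  ring

lemma sum_coprime (h : ℕ → ℕ → ℕ) {m n : ℕ} (hmn : m.Coprime n) :
    ∑ d ∈ (m * n).divisors, h d (m * n / d) =
      ∑ d ∈ m.divisors, ∑ e ∈ n.divisors, h (d * e) (m / d * (n / e)) := by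
  rw [← Finset.sum_product', Nat.divisors_mul, Finset.mul_def,
    Finset.sum_image hmn.mul_injOn_divisors]
  refine Finset.sum_congr rfl ?_
  rintro ⟨d, e⟩ hde
  simp only [Finset.mem_product, Nat.mem_divisors] at hde
  simp only
  rw [Nat.mul_div_mul_comm hde.1.1 hde.2.1]

/-- total count -/
def S (n : ℕ) : ℕ := ∑ d ∈ n.divisors, F d (n / d)

lemma F_mul_div {m n d e : ℕ} (hmn : m.Coprime n) (hd : d ∈ m.divisors) (he : e ∈ n.divisors) :
    F (d * e) (m / d * (n / e)) = F d (m / d) * F e (n / e) := by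
  rw [Nat.mem_divisors] at hd he
  apply F_mul
  · exact Nat.div_pos (Nat.le_of_dvd (Nat.pos_of_ne_zero hd.2) hd.1)
      (Nat.pos_of_dvd_of_pos hd.1 (Nat.pos_of_ne_zero hd.2))
  · exact Nat.div_pos (Nat.le_of_dvd (Nat.pos_of_ne_zero he.2) he.1)
      (Nat.pos_of_dvd_of_pos he.1 (Nat.pos_of_ne_zero he.2))
  · rwa [Nat.mul_div_cancel' hd.1, Nat.mul_div_cancel' he.1]

lemma S_mul {m n : ℕ} (hmn : m.Coprime n) : S (m * n) = S m * S n := by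
  rw [S, sum_coprime F hmn, S, S, Finset.sum_mul_sum]
  exact Finset.sum_congr rfl fun d hd => Finset.sum_congr rfl fun e he => F_mul_div hmn hd he

lemma F_one_left (z : ℕ) : F 1 z = z := by simp [F]

lemma F_one_right (x : ℕ) : F x 1 = 1 := by simp [F]

lemma F_prime_pow {p : ℕ} (hp : p.Prime) (i j : ℕ) :
    F (p ^ (i + 1)) (p ^ (j + 1)) = p ^ j * (p - 1) := by
  rw [F_eq _ _ (pow_pos hp.pos _)]
  have key : ∀ c, c ≤ j → p ^ (j + 1) / p ^ (c + 1) * Nat.totient (p ^ (c + 1))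
      = p ^ j * (p - 1) := by
    intro c hc
    rw [Nat.pow_div (by omega) hp.pos, Nat.totient_prime_pow_succ hp, ← mul_assoc, ← pow_add]
    congr 2
    omega
  rcases le_total i j with h | h
  · rw [Nat.gcd_eq_left (pow_dvd_pow p (by omega))]
    exact key i h
  · rw [Nat.gcd_eq_right (pow_dvd_pow p (by omega))]
    exact key j le_rfl

lemma geom (p k : ℕ) (hp : 0 < p) : ∑ i ∈ Finset.range k, p ^ (k - 1 - i) * (p - 1) + 1 = p ^ k := by
  rw [Finset.sum_range_reflect (fun j => p ^ j * (p - 1)) k]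
  obtain ⟨q, rfl⟩ : ∃ q, p = q + 1 := ⟨p - 1, by omega⟩
  induction k with
  | zero => simp
  | succ k ih =>
    rw [Finset.sum_range_succ]
    simp only [Nat.add_sub_cancel] at ih ⊢
    rw [pow_succ]
    linarith

/-- the interior sum -/
lemma interior {p : ℕ} (hp : p.Prime) (k : ℕ) :
    ∑ i ∈ Finset.range k, F (p ^ (i + 1)) (p ^ (k + 1 - (i + 1))) + 1 = p ^ k := by
  rw [← geom p k hp.pos]
  congr 1
  refine Finset.sum_congr rfl fun i hi => ?_
  rw [Finset.mem_range] at hi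
  rw [show k + 1 - (i + 1) = (k - 1 - i) + 1 by omega, F_prime_pow hp]

lemma sum_div_pow {p : ℕ} (hp : p.Prime) (k : ℕ) (h : ℕ → ℕ → ℕ) :
    ∑ d ∈ (p ^ k).divisors, h d (p ^ k / d) = ∑ i ∈ Finset.range (k + 1), h (p ^ i) (p ^ (k - i)) := by
  rw [Nat.sum_divisors_prime_pow hp]
  refine Finset.sum_congr rfl fun i hi => ?_
  rw [Finset.mem_range] at hi
  rw [Nat.pow_div (by omega) hp.pos]

lemma S_prime_pow {p : ℕ} (hp : p.Prime) (k : ℕ) : S (p ^ (k + 1)) = p ^ k * (p + 1) := by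
  rw [S, sum_div_pow hp, Finset.sum_range_succ, Finset.sum_range_succ']
  have := interior hp k
  simp only [pow_zero, Nat.sub_self, F_one_right, Nat.sub_zero, F_one_left]
  rw [pow_succ]
  linarith

lemma psi_mul {m n : ℕ} (hmn : m.Coprime n) :
    dedekindPsi (m * n) = dedekindPsi m * dedekindPsi n := by
  unfold dedekindPsi
  rw [hmn.primeFactors_mul, Finset.prod_union hmn.disjoint_primeFactors,
    Finset.prod_union hmn.disjoint_primeFactors,
    Nat.mul_div_mul_comm (show m.primeFactors.prod id ∣ m from Nat.prod_primeFactors_dvd m)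
      (show n.primeFactors.prod id ∣ n from Nat.prod_primeFactors_dvd n)]
  ring

lemma S_eq_psi (n : ℕ) (hn : n ≠ 0) : S n = dedekindPsi n := by
  induction n using Nat.recOnPosPrimePosCoprime with
  | zero => exact absurd rfl hn
  | one => simp [S, dedekindPsi, F]
  | prime_pow p k hp hk =>
    obtain ⟨k, rfl⟩ : ∃ j, k = j + 1 := ⟨k - 1, by omega⟩
    rw [S_prime_pow hp, dedekindPsi, Nat.primeFactors_prime_pow (by omega) hp]
    simp [pow_succ, hp.pos]
  | coprime a b ha hb hab iha ihb =>
    rw [S_mul hab, psi_mul hab, iha (by omega), ihb (by omega)]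

lemma card_matrices (n : ℕ) (hn : 0 < n) (P : ℤ → ℤ → Prop)
    [∀ x z, Decidable (P x z)] :
    Nat.card {M : Matrix (Fin 2) (Fin 2) ℤ //
        M 1 0 = 0 ∧ M 0 0 * M 1 1 = (n : ℤ) ∧ 0 ≤ M 0 1 ∧ M 0 1 < M 1 1 ∧
        Int.gcd (Int.gcd (M 0 0) (M 0 1)) (M 1 1) = 1 ∧ P (M 0 0) (M 1 1)} =
    ∑ d ∈ n.divisors, if P (d : ℤ) ((n / d : ℕ) : ℤ) then F d (n / d) else 0 := by
  rw [Nat.subtype_card (((n.divisors.filter (fun d : ℕ => P (d : ℤ) ((n / d : ℕ) : ℤ))).sigma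
    (fun d : ℕ => (Finset.range (n / d)).filter
      (fun y => Nat.gcd (Nat.gcd d y) (n / d) = 1))).image
    (fun t : (_ : ℕ) × ℕ => !![(t.1 : ℤ), (t.2 : ℤ); 0, ((n / t.1 : ℕ) : ℤ)])), Finset.card_image_of_injective,
    Finset.card_sigma, Finset.sum_filter]
  · rfl
  · rintro ⟨d, y⟩ ⟨d', y'⟩ h
    have h0 := congrFun (congrFun h 0) 0
    have h1 := congrFun (congrFun h 0) 1
    simp at h0 h1
    subst h0 h1
    rfl
  · intro M
    simp only [Finset.mem_image, Finset.mem_sigma, Finset.mem_filter, Nat.mem_divisors,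
      Finset.mem_range]
    constructor
    · rintro ⟨⟨d, y⟩, ⟨⟨⟨hd, _⟩, hP⟩, hy, hg⟩, rfl⟩
      simp only [Matrix.of_apply, Matrix.cons_val', Matrix.cons_val_zero, Matrix.cons_val_one,
        Matrix.cons_val_fin_one]
      refine ⟨trivial, ?_, by positivity, by exact_mod_cast hy, ?_, hP⟩
      · rw [← Nat.cast_mul, Nat.mul_div_cancel' hd]
      · rw [Int.gcd_natCast_natCast, Int.gcd_natCast_natCast]
        exact hg
    · rintro ⟨h10, hxz, hy0, hyz, hg, hP⟩
      have hz : 0 < M 1 1 := lt_of_le_of_lt hy0 hyz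
      have hx : 0 < M 0 0 := by
        have : 0 < M 0 0 * M 1 1 := by rw [hxz]; exact_mod_cast hn
        exact pos_of_mul_pos_left this hz.le
      obtain ⟨x, hx'⟩ := Int.eq_ofNat_of_zero_le hx.le
      obtain ⟨z, hz'⟩ := Int.eq_ofNat_of_zero_le hz.le
      obtain ⟨y, hy'⟩ := Int.eq_ofNat_of_zero_le hy0
      rw [hx', hz'] at hxz hP
      rw [hx', hy', hz'] at hg
      rw [hy', hz'] at hyz
      have hxz' : x * z = n := by exact_mod_cast hxz
      have hxpos : 0 < x := by rw [hx'] at hx; exact_mod_cast hx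
      have hdiv : n / x = z := by rw [← hxz', Nat.mul_div_cancel_left _ hxpos]
      refine ⟨⟨x, y⟩, ⟨⟨⟨⟨z, hxz'.symm⟩, hn.ne'⟩, ?_⟩, ?_, ?_⟩, ?_⟩
      · simpa [hdiv] using hP
      · simp only [hdiv]; exact_mod_cast hyz
      · simp only [hdiv]; simpa [Int.gcd_natCast_natCast] using hg
      · simp only [hdiv]
        ext i j
        fin_cases i <;> fin_cases j <;> simp [hx', hy', hz', h10]

lemma card_split (k b : ℕ) (hb : Odd b) (P : ℤ → ℤ → Prop)
    [∀ x z, Decidable (P x z)]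
    (hP : ∀ x z d e : ℤ, Odd d → Odd e → (P (x * d) (z * e) ↔ P x z)) :
    Nat.card {M : Matrix (Fin 2) (Fin 2) ℤ //
        M 1 0 = 0 ∧ M 0 0 * M 1 1 = ((2 ^ k * b : ℕ) : ℤ) ∧ 0 ≤ M 0 1 ∧ M 0 1 < M 1 1 ∧
        Int.gcd (Int.gcd (M 0 0) (M 0 1)) (M 1 1) = 1 ∧ P (M 0 0) (M 1 1)} =
    (∑ i ∈ Finset.range (k + 1),
      if P ((2 ^ i : ℕ) : ℤ) ((2 ^ (k - i) : ℕ) : ℤ) then F (2 ^ i) (2 ^ (k - i)) else 0)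
      * dedekindPsi b := by
  have hb0 : b ≠ 0 := by rintro rfl; simp at hb
  have hcop : Nat.Coprime (2 ^ k) b := (Nat.coprime_two_left.mpr hb).pow_left k
  rw [card_matrices _ (by positivity) P,
    sum_coprime (fun x z => if P (x : ℤ) (z : ℤ) then F x z else 0) hcop,
    ← sum_div_pow Nat.prime_two k (fun x z => if P (x : ℤ) (z : ℤ) then F x z else 0),
    ← S_eq_psi b hb0, S, Finset.sum_mul_sum]
  refine Finset.sum_congr rfl fun d hd => Finset.sum_congr rfl fun e he => ?_
  have he' := Nat.mem_divisors.mp he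
  have o1 : Odd (e : ℤ) := by exact_mod_cast hb.of_dvd_nat he'.1
  have o2 : Odd ((b / e : ℕ) : ℤ) := by
    exact_mod_cast hb.of_dvd_nat (Nat.div_dvd_of_dvd he'.1)
  rw [Nat.cast_mul, Nat.cast_mul]
  simp only [hP _ _ _ _ o1 o2]
  rw [F_mul_div hcop hd he]
  split_ifs <;> simp

end CountM


/-- For `m` even, `m = 2^a·b` with `b` odd: the number of matrices `[[x,y],[0,z]]`
with `xz = m`, `0 ≤ y < z`, `gcd(x,y,z)=1`, `z` odd, plus the number with `xz = 2m`,
`0 ≤ y < z`, `gcd(x,y,z)=1`, `x` and `z` even, equals the number with `xz = m`,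
`0 ≤ y < z`, `gcd(x,y,z)=1`, `x` odd; and all these counts equal `2^a·ψ(b)`. -/
theorem count_M2_eq_count_M1 (m a b : ℕ) (hm : 0 < m) (hme : Even m)
    (hb : Odd b) (hmab : m = 2 ^ a * b) :
    (Nat.card {M : Matrix (Fin 2) (Fin 2) ℤ //
        M 1 0 = 0 ∧ M 0 0 * M 1 1 = (m : ℤ) ∧ 0 ≤ M 0 1 ∧ M 0 1 < M 1 1 ∧
        Int.gcd (Int.gcd (M 0 0) (M 0 1)) (M 1 1) = 1 ∧ Odd (M 1 1)}
      + Nat.card {M : Matrix (Fin 2) (Fin 2) ℤ //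
        M 1 0 = 0 ∧ M 0 0 * M 1 1 = (2 * m : ℤ) ∧ 0 ≤ M 0 1 ∧ M 0 1 < M 1 1 ∧
        Int.gcd (Int.gcd (M 0 0) (M 0 1)) (M 1 1) = 1 ∧ Even (M 0 0) ∧ Even (M 1 1)}
      = Nat.card {M : Matrix (Fin 2) (Fin 2) ℤ //
        M 1 0 = 0 ∧ M 0 0 * M 1 1 = (m : ℤ) ∧ 0 ≤ M 0 1 ∧ M 0 1 < M 1 1 ∧
        Int.gcd (Int.gcd (M 0 0) (M 0 1)) (M 1 1) = 1 ∧ Odd (M 0 0)})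
    ∧ Nat.card {M : Matrix (Fin 2) (Fin 2) ℤ //
        M 1 0 = 0 ∧ M 0 0 * M 1 1 = (m : ℤ) ∧ 0 ≤ M 0 1 ∧ M 0 1 < M 1 1 ∧
        Int.gcd (Int.gcd (M 0 0) (M 0 1)) (M 1 1) = 1 ∧ Odd (M 0 0)}
      = 2 ^ a * dedekindPsi b := by
  have ha : a ≠ 0 := by
    rintro rfl
    rw [hmab, pow_zero, one_mul] at hme
    exact (Nat.not_even_iff_odd.mpr hb) hme
  obtain ⟨c, rfl⟩ : ∃ c, a = c + 1 := ⟨a - 1, by omega⟩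
  have e2 : (2 * m : ℤ) = ((2 ^ (c + 1 + 1) * b : ℕ) : ℤ) := by
    rw [hmab]; push_cast; ring
  rw [e2, hmab]
  have h1 := CountM.card_split (c + 1) b hb (fun _ z => Odd z)
    (by intro x z d e _ he; simp [Int.odd_mul, he])
  have h2 := CountM.card_split (c + 1 + 1) b hb (fun x z => Even x ∧ Even z)
    (by intro x z d e hd he
        simp [Int.even_mul, Int.not_even_iff_odd.mpr he, Int.not_even_iff_odd.mpr hd])
  have h3 := CountM.card_split (c + 1) b hb (fun x _ => Odd x)
    (by intro x z d e hd _; simp [Int.odd_mul, hd])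
  rw [h1, h2, h3]
  have s1 : (∑ i ∈ Finset.range (c + 1 + 1),
      if Odd ((2 ^ (c + 1 - i) : ℕ) : ℤ) then CountM.F (2 ^ i) (2 ^ (c + 1 - i)) else 0) = 1 := by
    rw [Finset.sum_range_succ, Finset.sum_eq_zero]
    · simp [CountM.F_one_right]
    · intro i hi
      rw [Finset.mem_range] at hi
      rw [if_neg]
      rw [Int.not_odd_iff_even, Int.even_coe_nat, Nat.even_pow]
      exact ⟨even_two, by omega⟩
  have s3 : (∑ i ∈ Finset.range (c + 1 + 1),
      if Odd ((2 ^ i : ℕ) : ℤ) then CountM.F (2 ^ i) (2 ^ (c + 1 - i)) else 0) = 2 ^ (c + 1) := by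
    rw [Finset.sum_range_succ', Finset.sum_eq_zero]
    · simp [CountM.F_one_left]
    · intro i hi
      rw [if_neg]
      rw [Int.not_odd_iff_even, Int.even_coe_nat, Nat.even_pow]
      exact ⟨even_two, by omega⟩
  have s2 : (∑ i ∈ Finset.range (c + 1 + 1 + 1),
      if Even ((2 ^ i : ℕ) : ℤ) ∧ Even ((2 ^ (c + 1 + 1 - i) : ℕ) : ℤ) then
        CountM.F (2 ^ i) (2 ^ (c + 1 + 1 - i)) else 0) + 1 = 2 ^ (c + 1) := by
    rw [← CountM.interior Nat.prime_two (c + 1), Finset.sum_range_succ, Finset.sum_range_succ',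
      if_neg (by simp), if_neg (by simp)]
    simp only [add_zero]
    congr 1
    refine Finset.sum_congr rfl fun i hi => ?_
    rw [Finset.mem_range] at hi
    rw [if_pos]
    rw [Int.even_coe_nat, Int.even_coe_nat, Nat.even_pow, Nat.even_pow]
    exact ⟨⟨even_two, by omega⟩, even_two, by omega⟩
  refine ⟨?_, ?_⟩
  · rw [← add_mul, s1, s3, ← s2, add_comm]
  · rw [s3]
end

section
/- Let m be a positive odd integer. Then the double cosets Γ₀(2)⁺·[[1,0],[0,m]]·Γ₀(2), Γ₀(2)⁺·[[m,0],[0,1]]·Γ₀(2), Γ₀(2)⁺·[[m,0],[0,1]]·Γ₀(2)⁺ and Γ₀(2)⁺·[[1,0],[0,m]]·Γ₀(2)⁺ all coincide and equal the disjoint union of left cosets Γ₀(2)⁺·[[x,y],[0,z]] over xz = m, 0 ≤ y < z, gcd(x,y,z) = 1. -/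
noncomputable section

/-- 2×2 real matrices. -/
abbrev M2R := Matrix (Fin 2) (Fin 2) ℝ

/-- `A` represents an element of `Γ₀(2) ⊆ PSL(2,ℝ)`: it is an integral matrix of
determinant 1 whose lower-left entry is even. -/
def IsGamma0Two (A : M2R) : Prop :=
  ∃ B : Matrix (Fin 2) (Fin 2) ℤ, A = B.map (fun x => (x : ℝ)) ∧ B.det = 1 ∧ (2 : ℤ) ∣ B 1 0

/-- The Fricke involution `w₂ = 2^{-1/2}·[[0,-1],[2,0]]`. -/
def w2mat : M2R := (Real.sqrt 2)⁻¹ • !![0, -1; 2, 0]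

/-- `A` represents an element of `Γ₀(2)⁺`, the extension of `Γ₀(2)` by the Fricke
involution `w₂` (note that `-B ∈ Γ₀(2)` whenever `B ∈ Γ₀(2)`, so signs are absorbed). -/
def IsGamma0TwoPlus (A : M2R) : Prop :=
  IsGamma0Two A ∨ ∃ B : M2R, IsGamma0Two B ∧ A = B * w2mat

/-- Equality of matrices up to a positive real scalar (equality in `PGL(2,ℝ)⁺`). -/
def projEq (A B : M2R) : Prop := ∃ c : ℝ, 0 < c ∧ A = c • B

/-- The set `M^m` (for `m` odd) of matrices `[[x,y],[0,z]]` with `xz = m`,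
`0 ≤ y < z` and `gcd(x,y,z) = 1`. -/
def MSetOdd (m : ℕ) : Set M2R :=
  {A | ∃ x y z : ℕ, x * z = m ∧ y < z ∧ Nat.gcd (Nat.gcd x y) z = 1 ∧
    A = !![(x : ℝ), (y : ℝ); 0, (z : ℝ)]}

abbrev MZ := Matrix (Fin 2) (Fin 2) ℤ

def ic (B : MZ) : M2R := B.map (fun x => (x : ℝ))

def GZ (B : MZ) : Prop := B.det = 1 ∧ (2 : ℤ) ∣ B 1 0

lemma ic_mul (A B : MZ) : ic (A * B) = ic A * ic B := by
  ext i j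
  simp [ic, Matrix.mul_apply, Fin.sum_univ_two]

lemma ic_one : ic 1 = 1 := by
  ext i j
  fin_cases i <;> fin_cases j <;> simp [ic]

lemma ic_lit (a b c d : ℤ) : ic !![a, b; c, d] = !![(a : ℝ), (b : ℝ); (c : ℝ), (d : ℝ)] := by
  ext i j
  fin_cases i <;> fin_cases j <;> simp [ic]

lemma isG_iff (A : M2R) : IsGamma0Two A ↔ ∃ B, GZ B ∧ A = ic B := by
  constructor
  · rintro ⟨B, h, h1, h2⟩
    exact ⟨B, ⟨h1, h2⟩, h⟩
  · rintro ⟨B, ⟨h1, h2⟩, h⟩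
    exact ⟨B, h, h1, h2⟩

/-- Primitive integral matrices of determinant `m` with even lower-left entry. -/
def PrimZ (m : ℕ) (N : MZ) : Prop :=
  N.det = m ∧ (2 : ℤ) ∣ N 1 0 ∧ ∀ k : ℤ, (∀ i j, k ∣ N i j) → IsUnit k

lemma GZ.mul {A B : MZ} (hA : GZ A) (hB : GZ B) : GZ (A * B) := by
  refine ⟨by rw [Matrix.det_mul, hA.1, hB.1, one_mul], ?_⟩
  rw [Matrix.mul_apply, Fin.sum_univ_two]
  exact dvd_add (hA.2.mul_right _) (hB.2.mul_left _)

lemma GZ.adj {A : MZ} (hA : GZ A) : GZ A.adjugate := by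
  refine ⟨?_, ?_⟩
  · have := hA.1
    rw [Matrix.det_adjugate, this]; simp
  · have := hA.2
    rw [Matrix.adjugate_fin_two]; simpa using this

lemma GZ.adj_mul {A : MZ} (hA : GZ A) : A.adjugate * A = 1 := by
  rw [Matrix.adjugate_mul, hA.1, one_smul]

lemma GZ.mul_adj {A : MZ} (hA : GZ A) : A * A.adjugate = 1 := by
  rw [Matrix.mul_adjugate, hA.1, one_smul]

lemma GZ.one : GZ 1 := ⟨by simp, by simp⟩

lemma PrimZ.lmul {m : ℕ} {A N : MZ} (hA : GZ A) (hN : PrimZ m N) : PrimZ m (A * N) := by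
  refine ⟨by rw [Matrix.det_mul, hA.1, hN.1, one_mul], ?_, ?_⟩
  · rw [Matrix.mul_apply, Fin.sum_univ_two]
    exact dvd_add (hA.2.mul_right _) (hN.2.1.mul_left _)
  · intro k hk
    refine hN.2.2 k fun i j => ?_
    have : N = A.adjugate * (A * N) := by rw [← mul_assoc, hA.adj_mul, one_mul]
    rw [this, Matrix.mul_apply]
    exact Finset.dvd_sum fun l _ => (hk l j).mul_left _

lemma PrimZ.rmul {m : ℕ} {A N : MZ} (hA : GZ A) (hN : PrimZ m N) : PrimZ m (N * A) := by
  refine ⟨by rw [Matrix.det_mul, hA.1, hN.1, mul_one], ?_, ?_⟩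
  · rw [Matrix.mul_apply, Fin.sum_univ_two]
    exact dvd_add (hN.2.1.mul_right _) (hA.2.mul_left _)
  · intro k hk
    refine hN.2.2 k fun i j => ?_
    have : N = (N * A) * A.adjugate := by rw [mul_assoc, hA.mul_adj, mul_one]
    rw [this, Matrix.mul_apply]
    exact Finset.dvd_sum fun l _ => (hk i l).mul_right _

lemma PrimZ.neg {m : ℕ} {N : MZ} (hN : PrimZ m N) : PrimZ m (-N) := by
  have h : GZ (-1) := ⟨by simp [Matrix.det_fin_two], by simp⟩
  simpa using hN.lmul h

/-- integral Fricke matrix -/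
def WZ : MZ := !![0, -1; 2, 0]

/-- conjugation by the Fricke matrix -/
def sg (N : MZ) : MZ := !![N 1 1, -(N 1 0 / 2); -2 * N 0 1, N 0 0]

lemma lit (N : MZ) : N = !![N 0 0, N 0 1; N 1 0, N 1 1] := Matrix.eta_fin_two N

lemma sg_comm {N : MZ} (h : (2 : ℤ) ∣ N 1 0) : N * WZ = WZ * sg N := by
  obtain ⟨c, hc⟩ := h
  ext i j
  fin_cases i <;> fin_cases j <;>
    simp [WZ, sg, Matrix.mul_apply, Fin.sum_univ_two, hc] <;> ring

lemma sg_comm' {N : MZ} (h : (2 : ℤ) ∣ N 1 0) : WZ * N = sg N * WZ := by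
  obtain ⟨c, hc⟩ := h
  ext i j
  fin_cases i <;> fin_cases j <;>
    simp [WZ, sg, Matrix.mul_apply, Fin.sum_univ_two, hc] <;> ring

lemma sg_det {N : MZ} (h : (2 : ℤ) ∣ N 1 0) : (sg N).det = N.det := by
  obtain ⟨c, hc⟩ := h
  simp [sg, Matrix.det_fin_two, hc]; ring

lemma sg_dvd (N : MZ) : (2 : ℤ) ∣ sg N 1 0 := by
  simp [sg]

lemma GZ.sg {N : MZ} (h : GZ N) : GZ (sg N) := ⟨by rw [sg_det h.2, h.1], sg_dvd N⟩

lemma sg_sg {N : MZ} (h : (2 : ℤ) ∣ N 1 0) : sg (sg N) = N := by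
  obtain ⟨c, hc⟩ := h
  ext i j
  fin_cases i <;> fin_cases j <;> simp [sg, hc]
  omega

lemma sg_mul {A B : MZ} (hA : (2 : ℤ) ∣ A 1 0) (hB : (2 : ℤ) ∣ B 1 0) :
    sg (A * B) = sg A * sg B := by
  obtain ⟨c, hc⟩ := hA
  obtain ⟨d, hd⟩ := hB
  have : (2 * c * B 0 0 + A 1 1 * (2 * d)) / 2 = c * B 0 0 + A 1 1 * d := by
    rw [show 2 * c * B 0 0 + A 1 1 * (2 * d) = 2 * (c * B 0 0 + A 1 1 * d) by ring]
    simp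
  ext i j
  fin_cases i <;> fin_cases j <;>
    simp [sg, Matrix.mul_apply, Fin.sum_univ_two, hc, hd, this] <;> ring

lemma PrimZ.sg {m : ℕ} (hmo : Odd m) {N : MZ} (h : PrimZ m N) : PrimZ m (sg N) := by
  refine ⟨by rw [sg_det h.2.1, h.1], sg_dvd N, fun k hk => ?_⟩
  obtain ⟨hd, ⟨c, hc⟩, hp⟩ := h
  have h00 := hk 0 0
  have h01 := hk 0 1
  have h10 := hk 1 0
  have h11 := hk 1 1
  simp [_root_.sg, hc] at h00 h01 h10 h11
  have hkm : k ∣ (m : ℤ) := by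
    rw [← hd, Matrix.det_fin_two, hc]
    refine dvd_sub (h00.mul_left _) ?_
    exact (h01.mul_left (N 0 1 * 2)).trans (by rw [mul_assoc])
  have hco : IsCoprime k 2 := by
    have : IsCoprime (m : ℤ) 2 := by
      have := (Nat.coprime_two_right).2 hmo
      exact_mod_cast Nat.isCoprime_iff_coprime.2 this
    exact this.of_isCoprime_of_dvd_left hkm
  refine hp k fun i j => ?_
  fin_cases i <;> fin_cases j <;> simp [hc]
  · exact h11
  · exact hco.dvd_of_dvd_mul_left h10
  · exact h01.mul_left _
  · exact h00

/-- Hermite normal form. -/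
lemma hermite {m : ℕ} (hm : 0 < m) (hmo : Odd m) {N : MZ} (h : PrimZ m N) :
    ∃ B : MZ, GZ B ∧ ∃ x y z : ℕ, x * z = m ∧ y < z ∧ x = Int.gcd (N 0 0) (N 1 0) ∧
      N = B * !![(x : ℤ), y; 0, z] := by
  have hd := h.1
  rw [Matrix.det_fin_two] at hd
  have hmo' : Odd (m : ℤ) := by exact_mod_cast hmo
  obtain ⟨a', ha⟩ := Int.gcd_dvd_left (N 0 0) (N 1 0)
  obtain ⟨c', hc⟩ := Int.gcd_dvd_right (N 0 0) (N 1 0)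
  have hbez := Int.gcd_eq_gcd_ab (N 0 0) (N 1 0)
  set g := Int.gcd (N 0 0) (N 1 0) with hg
  set u := Int.gcdA (N 0 0) (N 1 0)
  set v := Int.gcdB (N 0 0) (N 1 0)
  have hz : (g : ℤ) * (a' * N 1 1 - N 0 1 * c') = m := by
    rw [← hd]; linear_combination (-N 1 1) * ha + N 0 1 * hc
  have hg0 : (0 : ℤ) < g := by
    rcases (Nat.zero_le g).eq_or_lt with h0 | h0
    · rw [← h0] at hz; simp at hz; omega
    · exact_mod_cast h0
  have hgo : Odd (g : ℤ) := by
    rw [← hz, Int.odd_mul] at hmo'; exact hmo'.1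
  have hbez' : a' * u + c' * v = 1 := by
    have : (g : ℤ) * (a' * u + c' * v) = g * 1 := by
      linear_combination -hbez - u * ha - v * hc
    exact mul_left_cancel₀ hg0.ne' this
  have hc2 : (2 : ℤ) ∣ c' := by
    have h2 := h.2.1
    rw [hc] at h2
    have : IsCoprime (2 : ℤ) g := by
      rw [Int.isCoprime_iff_gcd_eq_one]
      exact Int.isCoprime_iff_gcd_eq_one.1
        ((Int.prime_two.coprime_iff_not_dvd).2 (by rw [← even_iff_two_dvd]; simpa using hgo))
    exact this.dvd_of_dvd_mul_left h2
  set z := a' * N 1 1 - N 0 1 * c' with hzdef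
  have hm' : (0 : ℤ) < m := by exact_mod_cast hm
  have hz0 : 0 < z := by
    rw [← hz] at hm'
    exact (pos_iff_pos_of_mul_pos hm').1 hg0
  set y0 := u * N 0 1 + v * N 1 1 with hy0
  have hy1 := Int.emod_nonneg y0 hz0.ne'
  have hy2 := Int.emod_lt_of_pos y0 hz0
  have hy3 := Int.emod_add_mul_ediv y0 z
  set q := y0 / z
  set r := y0 % z
  refine ⟨!![a', -v + a' * q; c', u + c' * q], ⟨?_, by simpa using hc2⟩, g, r.toNat, z.toNat,
    ?_, ?_, rfl, ?_⟩
  · rw [Matrix.det_fin_two]; simp; linear_combination hbez'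
  · have : ((g * z.toNat : ℕ) : ℤ) = m := by
      rw [Nat.cast_mul, Int.toNat_of_nonneg hz0.le]; exact hz
    exact_mod_cast this
  · omega
  · rw [Int.toNat_of_nonneg hy1, Int.toNat_of_nonneg hz0.le]
    ext i j
    fin_cases i <;> fin_cases j <;> simp [Matrix.mul_apply, Fin.sum_univ_two]
    · linear_combination ha
    · linear_combination (-N 0 1) * hbez' - a' * hy3 + a' * hy0 -v*hzdef
    · linear_combination hc
    · linear_combination (-N 1 1) * hbez' - c' * hy3 + c' * hy0 +u*hzdef

lemma prim_upper {m x y z : ℕ} (hxz : x * z = m) :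
    PrimZ m !![(x : ℤ), y; 0, z] ↔ Nat.gcd (Nat.gcd x y) z = 1 := by
  constructor
  · rintro ⟨-, -, h⟩
    have := h (Nat.gcd (Nat.gcd x y) z : ℕ) (by
      intro i j
      have h1 : Nat.gcd (Nat.gcd x y) z ∣ x := (Nat.gcd_dvd_left _ _).trans (Nat.gcd_dvd_left _ _)
      have h2 : Nat.gcd (Nat.gcd x y) z ∣ y := (Nat.gcd_dvd_left _ _).trans (Nat.gcd_dvd_right _ _)
      have h3 : Nat.gcd (Nat.gcd x y) z ∣ z := Nat.gcd_dvd_right _ _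
      fin_cases i <;> fin_cases j <;> simp
      · exact_mod_cast h1
      · exact_mod_cast h2
      · exact_mod_cast h3)
    rw [Int.isUnit_iff_natAbs_eq] at this
    simpa using this
  · intro h
    refine ⟨by rw [Matrix.det_fin_two]; simp [← hxz], by simp, fun k hk => ?_⟩
    have h00 := hk 0 0
    have h01 := hk 0 1
    have h11 := hk 1 1
    simp [Int.dvd_natCast] at h00 h01 h11
    rw [Int.isUnit_iff_natAbs_eq, ← Nat.dvd_one, ← h]
    exact Nat.dvd_gcd (Nat.dvd_gcd h00 h01) h11

lemma exists_s {x y z : ℕ} (hxo : Odd x) (hz : 0 < z) (h : Nat.gcd (Nat.gcd x y) z = 1) :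
    ∃ s : ℕ, Nat.Coprime (x + 2 * s * y) (2 * s * z) := by
  refine ⟨∏ p ∈ z.primeFactors.filter (fun p => ¬ p ∣ x), p, ?_⟩
  set s := ∏ p ∈ z.primeFactors.filter (fun p => ¬ p ∣ x), p with hs
  have hs1 : ∀ p, p.Prime → p ∣ s → ¬ p ∣ x := by
    intro p hp hps
    obtain ⟨q, hq, hpq⟩ := (hp.prime.dvd_finsetProd_iff _).1 hps
    rw [Finset.mem_filter] at hq
    rw [(Nat.prime_dvd_prime_iff_eq hp (Nat.prime_of_mem_primeFactors hq.1)).1 hpq]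
    exact hq.2
  have hs2 : ∀ p, p.Prime → p ∣ z → ¬ p ∣ x → p ∣ s := by
    intro p hp hpz hpx
    exact Finset.dvd_prod_of_mem _ (Finset.mem_filter.2
      ⟨Nat.mem_primeFactors.2 ⟨hp, hpz, hz.ne'⟩, hpx⟩)
  refine Nat.coprime_of_dvd fun p hp h1 h2 => ?_
  have key : p ∣ 2 * s → False := by
    intro h3
    have hpx : p ∣ x := (Nat.dvd_add_left (h3.mul_right y)).1 h1
    rcases (hp.dvd_mul).1 h3 with h4 | h4
    · rw [Nat.prime_dvd_prime_iff_eq hp Nat.prime_two] at h4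
      subst h4
      exact (Nat.not_even_iff_odd.2 hxo) (even_iff_two_dvd.2 hpx)
    · exact hs1 p hp h4 hpx
  rcases (hp.dvd_mul).1 h2 with h3 | h3
  · exact key h3
  · by_cases hpx : p ∣ x
    · have h4 : p ∣ 2 * s * y := (Nat.dvd_add_right hpx).1 h1
      rcases (hp.dvd_mul).1 h4 with h5 | h5
      · exact key h5
      · have : p ∣ 1 := h ▸ Nat.dvd_gcd (Nat.dvd_gcd hpx h5) h3
        exact hp.one_lt.ne' (Nat.dvd_one.1 this)
    · exact key ((hs2 p hp h3 hpx).mul_left 2)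

/-- Elementary divisor form relative to `Γ₀(2)`. -/
lemma smith {m : ℕ} (hm : 0 < m) (hmo : Odd m) {N : MZ} (h : PrimZ m N) :
    ∃ B C : MZ, GZ B ∧ GZ C ∧ N = B * !![1, 0; 0, (m : ℤ)] * C := by
  obtain ⟨B, hB, x, y, z, hxz, hyz, -, hN⟩ := hermite hm hmo h
  have hP : PrimZ m !![(x : ℤ), y; 0, z] := by
    have := h.lmul hB.adj
    rwa [hN, ← mul_assoc, hB.adj_mul, one_mul] at this
  have hxo : Odd x := by rw [← hxz, Nat.odd_mul] at hmo; exact hmo.1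
  obtain ⟨s, hs⟩ := exists_s hxo (by omega) ((prim_upper hxz).1 hP)
  have hL : GZ !![1, 0; 2 * (s : ℤ), 1] := ⟨by simp [Matrix.det_fin_two], by simp⟩
  obtain ⟨B', hB', x', y', z', hxz', -, hx', hN'⟩ := hermite hm hmo (hP.rmul hL)
  have hx1 : x' = 1 := by
    refine hx'.trans (Eq.trans ?_ hs.gcd_eq_one)
    rw [← Int.gcd_natCast_natCast]
    congr 1
    · simp [Matrix.mul_apply, Fin.sum_univ_two]; ring
    · simp [Matrix.mul_apply, Fin.sum_univ_two]; ring
  subst hx1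
  rw [one_mul] at hxz'
  subst hxz'
  have hU : GZ !![1, (y' : ℤ); 0, 1] := ⟨by simp [Matrix.det_fin_two], by simp⟩
  refine ⟨B * B', !![1, (y' : ℤ); 0, 1] * (!![1, 0; 2 * (s : ℤ), 1] : MZ).adjugate,
    hB.mul hB', hU.mul hL.adj, ?_⟩
  have e1 : (!![((1 : ℕ) : ℤ), y'; 0, z'] : MZ) = !![1, 0; 0, (z' : ℤ)] * !![1, (y' : ℤ); 0, 1] := by
    simp
  rw [e1] at hN'
  rw [hN, ← mul_one !![(x : ℤ), y; 0, z], ← hL.mul_adj, ← mul_assoc _ _ (Matrix.adjugate _), hN']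
  simp only [mul_assoc]

lemma smith' {m : ℕ} (hm : 0 < m) (hmo : Odd m) {N : MZ} (h : PrimZ m N) :
    ∃ B C : MZ, GZ B ∧ GZ C ∧ N = B * !![(m : ℤ), 0; 0, 1] * C := by
  obtain ⟨B, C, hB, hC, hN⟩ := smith hm hmo (h.sg hmo)
  refine ⟨sg B, sg C, hB.sg, hC.sg, ?_⟩
  have hD : (2 : ℤ) ∣ (!![1, 0; 0, (m : ℤ)] : MZ) 1 0 := by simp
  have hBD : (2 : ℤ) ∣ (B * (!![1, 0; 0, (m : ℤ)] : MZ)) 1 0 := by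
    have := hB.2
    rw [Matrix.mul_apply, Fin.sum_univ_two]
    exact dvd_add (this.mul_right _) (hD.mul_left _)
  rw [← sg_sg h.2.1, hN, sg_mul hBD hC.2, sg_mul hB.2 hD]
  congr 2

lemma w2_eq : w2mat = (Real.sqrt 2)⁻¹ • ic WZ := by
  rw [w2mat, WZ, ic_lit]; simp

lemma ic_WZ_sq : ic WZ * ic WZ = (-2 : ℝ) • 1 := by
  rw [WZ, ic_lit]
  ext i j
  fin_cases i <;> fin_cases j <;> simp [Matrix.mul_apply, Fin.sum_univ_two]

lemma ic_neg (N : MZ) : ic (-N) = - ic N := by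
  ext i j
  simp [ic]

lemma isGP_iff (A : M2R) : IsGamma0TwoPlus A ↔
    ∃ B, GZ B ∧ (A = ic B ∨ A = (Real.sqrt 2)⁻¹ • (ic B * ic WZ)) := by
  unfold IsGamma0TwoPlus
  simp only [isG_iff, w2_eq]
  constructor
  · rintro (⟨B, h, rfl⟩ | ⟨_, ⟨B, h, rfl⟩, rfl⟩)
    · exact ⟨B, h, Or.inl rfl⟩
    · exact ⟨B, h, Or.inr (by simp)⟩
  · rintro ⟨B, h, rfl | rfl⟩
    · exact Or.inl ⟨B, h, rfl⟩
    · exact Or.inr ⟨_, ⟨B, h, rfl⟩, by simp⟩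

/-- The common description of all the double cosets. -/
def TT (m : ℕ) (A : M2R) : Prop :=
  ∃ c : ℝ, 0 < c ∧ ∃ N : MZ, PrimZ m N ∧ (A = c • ic N ∨ A = c • (ic WZ * ic N))

lemma TT.smul {m : ℕ} {A : M2R} (h : TT m A) {d : ℝ} (hd : 0 < d) : TT m (d • A) := by
  obtain ⟨c, hc, N, hN, rfl | rfl⟩ := h
  · exact ⟨d * c, mul_pos hd hc, N, hN, Or.inl (by rw [smul_smul])⟩
  · exact ⟨d * c, mul_pos hd hc, N, hN, Or.inr (by rw [smul_smul])⟩

lemma TT.lW {m : ℕ} {A : M2R} (h : TT m A) : TT m (ic WZ * A) := by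
  obtain ⟨c, hc, N, hN, rfl | rfl⟩ := h
  · exact ⟨c, hc, N, hN, Or.inr (by simp)⟩
  · refine ⟨c * 2, by positivity, -N, hN.neg, Or.inl ?_⟩
    rw [Matrix.mul_smul, ← mul_assoc, ic_WZ_sq, ic_neg, mul_smul]
    simp

lemma TT.lG {m : ℕ} {A : M2R} (h : TT m A) {B : MZ} (hB : GZ B) : TT m (ic B * A) := by
  obtain ⟨c, hc, N, hN, rfl | rfl⟩ := h
  · exact ⟨c, hc, _, hN.lmul hB, Or.inl (by simp [ic_mul])⟩
  · refine ⟨c, hc, _, hN.lmul hB.sg, Or.inr ?_⟩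
    rw [Matrix.mul_smul, ← mul_assoc, ← ic_mul, sg_comm hB.2, ic_mul, ic_mul, mul_assoc]

lemma TT.rG {m : ℕ} {A : M2R} (h : TT m A) {B : MZ} (hB : GZ B) : TT m (A * ic B) := by
  obtain ⟨c, hc, N, hN, rfl | rfl⟩ := h
  · exact ⟨c, hc, _, hN.rmul hB, Or.inl (by simp [ic_mul])⟩
  · exact ⟨c, hc, _, hN.rmul hB, Or.inr (by simp [ic_mul, mul_assoc])⟩

lemma TT.rW {m : ℕ} (hmo : Odd m) {A : M2R} (h : TT m A) : TT m (A * ic WZ) := by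
  obtain ⟨c, hc, N, hN, rfl | rfl⟩ := h
  · refine ⟨c, hc, _, hN.sg hmo, Or.inr ?_⟩
    rw [Matrix.smul_mul, ← ic_mul, sg_comm hN.2.1, ic_mul]
  · have h1 : TT m (ic WZ * (ic WZ * ic (sg N))) :=
      TT.lW ⟨1, one_pos, _, hN.sg hmo, Or.inr (by simp)⟩
    have := h1.smul hc
    rwa [← ic_mul WZ (sg N), ← sg_comm hN.2.1, ic_mul, ← mul_assoc, ← Matrix.smul_mul] at this

lemma TT.lP {m : ℕ} {A g : M2R} (h : TT m A) (hg : IsGamma0TwoPlus g) : TT m (g * A) := by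
  obtain ⟨B, hB, rfl | rfl⟩ := (isGP_iff g).1 hg
  · exact h.lG hB
  · rw [Matrix.smul_mul, mul_assoc]
    exact (h.lW.lG hB).smul (by positivity)

lemma TT.rP {m : ℕ} (hmo : Odd m) {A g : M2R} (h : TT m A) (hg : IsGamma0TwoPlus g) :
    TT m (A * g) := by
  obtain ⟨B, hB, rfl | rfl⟩ := (isGP_iff g).1 hg
  · exact h.rG hB
  · rw [Matrix.mul_smul, ← mul_assoc]
    exact ((h.rG hB).rW hmo).smul (by positivity)

lemma TT_of_prim {m : ℕ} {N : MZ} (h : PrimZ m N) : TT m (ic N) :=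
  ⟨1, one_pos, N, h, Or.inl (by simp)⟩

lemma TT_D (m : ℕ) : TT m !![1, 0; 0, (m : ℝ)] := by
  have : PrimZ m !![((1 : ℕ) : ℤ), (0 : ℕ); 0, (m : ℕ)] := (prim_upper (by simp)).2 (by simp)
  simpa [ic_lit] using TT_of_prim this

lemma TT_D' (m : ℕ) : TT m !![(m : ℝ), 0; 0, 1] := by
  have : PrimZ m !![((m : ℕ) : ℤ), (0 : ℕ); 0, (1 : ℕ)] := (prim_upper (by simp)).2 (by simp)
  simpa [ic_lit] using TT_of_prim this

lemma TT_M {m : ℕ} {γ : M2R} (h : γ ∈ MSetOdd m) : TT m γ := by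
  obtain ⟨x, y, z, hxz, -, hg, rfl⟩ := h
  simpa [ic_lit] using TT_of_prim ((prim_upper hxz).2 hg)

/-- If every primitive `N` is in `Γ₀(2) X`, every element of `TT` is in `Γ₀(2)⁺ X` up to scalars. -/
lemma TT.out {m : ℕ} {A : M2R} (h : TT m A) (S : M2R → Prop)
    (hS : ∀ N, PrimZ m N → ∃ B X, GZ B ∧ S X ∧ ic N = ic B * X) :
    ∃ g X, IsGamma0TwoPlus g ∧ S X ∧ projEq A (g * X) := by
  obtain ⟨c, hc, N, hN, rfl | rfl⟩ := h
  · obtain ⟨B, X, hB, hX, e⟩ := hS N hN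
    exact ⟨ic B, X, (isGP_iff _).2 ⟨B, hB, Or.inl rfl⟩, hX, c, hc, by rw [e]⟩
  · obtain ⟨B, X, hB, hX, e⟩ := hS N hN
    refine ⟨(Real.sqrt 2)⁻¹ • (ic (sg B) * ic WZ), X,
      (isGP_iff _).2 ⟨sg B, hB.sg, Or.inr rfl⟩, hX, c * Real.sqrt 2, by positivity, ?_⟩
    rw [← ic_mul (sg B), ← sg_comm' hB.2, e, Matrix.smul_mul, smul_smul, mul_assoc c,
      mul_inv_cancel₀ (by positivity), mul_one, ic_mul, mul_assoc]

lemma disj {m : ℕ} (hm : 0 < m) (hmo : Odd m) (γ : M2R) (hγ : γ ∈ MSetOdd m) (γ' : M2R)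
    (hγ' : γ' ∈ MSetOdd m) (h : ∃ g : M2R, IsGamma0TwoPlus g ∧ projEq γ' (g * γ)) : γ = γ' := by
  obtain ⟨x, y, z, hxz, hyz, -, rfl⟩ := hγ
  obtain ⟨x', y', z', hxz', hyz', -, rfl⟩ := hγ'
  obtain ⟨g, hg, c, hc, e⟩ := h
  have hx : 0 < x := Nat.pos_of_ne_zero (by rintro rfl; simp at hxz; omega)
  have hx' : 0 < x' := Nat.pos_of_ne_zero (by rintro rfl; simp at hxz'; omega)
  have hm' : (0 : ℝ) < m := by exact_mod_cast hm
  have hR : (x : ℝ) * z = m := by exact_mod_cast hxz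
  have hR' : (x' : ℝ) * z' = m := by exact_mod_cast hxz'
  have hdet := congrArg Matrix.det e
  rw [Matrix.det_smul, Matrix.det_mul, Matrix.det_fin_two_of, Matrix.det_fin_two_of] at hdet
  simp [hR, hR'] at hdet
  obtain ⟨B, hB, rfl | rfl⟩ := (isGP_iff g).1 hg
  · have hdB : (ic B).det = 1 := by
      have := hB.1
      rw [Matrix.det_fin_two] at this ⊢
      simp only [ic, Matrix.map_apply]
      exact_mod_cast this
    rw [hdB, one_mul] at hdet
    have hc1 : c = 1 := by
      have : c ^ 2 = 1 := by
        have : (c ^ 2 - 1) * m = 0 := by linarith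
        rcases mul_eq_zero.1 this with h | h <;> linarith
      nlinarith
    subst hc1
    have hBd := hB.1
    rw [Matrix.det_fin_two] at hBd
    have e00 := congrFun (congrFun e 0) 0
    have e01 := congrFun (congrFun e 0) 1
    have e10 := congrFun (congrFun e 1) 0
    have e11 := congrFun (congrFun e 1) 1
    simp [Matrix.mul_apply, Fin.sum_univ_two, ic] at e00 e01 e10 e11
    norm_cast at e00 e01 e10 e11
    have hr : B 1 0 = 0 := by
      rcases e10 with h | h
      · exact h
      · omega
    rw [hr] at hBd e11
    have hp : B 0 0 = 1 := by
      have h1 : B 0 0 * B 1 1 = 1 := by linarith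
      have : 0 < B 0 0 := by
        have : 0 < B 0 0 * (x : ℤ) := by rw [← e00]; exact_mod_cast hx'
        exact pos_of_mul_pos_left this (by positivity)
      rcases Int.eq_one_or_neg_one_of_mul_eq_one h1 with h | h <;> omega
    have hs : B 1 1 = 1 := by rw [hp] at hBd; linarith
    rw [hp] at e00 e01
    rw [hs] at e11
    have exx : x' = x := by zify; linarith
    have ezz : z' = z := by zify; linarith
    have eyy : y' = y := by
      subst ezz
      have : (y' : ℤ) % z' = y % z' := by
        rw [e01]; simp
      rw [Int.emod_eq_of_lt (by positivity) (by exact_mod_cast hyz'),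
        Int.emod_eq_of_lt (by positivity) (by exact_mod_cast hyz)] at this
      exact_mod_cast this
    rw [exx, eyy, ezz]
  · exfalso
    have e00 := congrFun (congrFun e 0) 0
    simp [Matrix.mul_apply, Fin.sum_univ_two, ic, WZ] at e00
    have hd1 : ((Real.sqrt 2)⁻¹ • (ic B * ic WZ)).det = 1 := by
      have := hB.1
      rw [Matrix.det_fin_two] at this
      have h2 : ((B 0 0 : ℝ) * B 1 1 - B 0 1 * B 1 0) = 1 := by exact_mod_cast this
      rw [Matrix.det_smul, Matrix.det_mul, Matrix.det_fin_two, Matrix.det_fin_two]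
      simp [ic, WZ, h2]
    rw [hd1, one_mul] at hdet
    have hc1 : c = 1 := by
      have : c ^ 2 = 1 := by
        have : (c ^ 2 - 1) * m = 0 := by linarith
        rcases mul_eq_zero.1 this with h | h <;> linarith
      nlinarith
    subst hc1
    have hsq : 2 * (x' : ℝ) ^ 2 = (B 0 1 * 2 * x) ^ 2 := by
      have h2 : Real.sqrt 2 * x' = B 0 1 * 2 * x := by
        rw [e00]; field_simp
      rw [← h2, mul_pow, Real.sq_sqrt (by norm_num)]
    have hsq' : 2 * (x' : ℤ) ^ 2 = (B 0 1 * 2 * x) ^ 2 := by exact_mod_cast hsq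
    have hev : Even ((x' : ℤ) ^ 2) := ⟨(B 0 1 * x) ^ 2, by linarith [hsq', mul_pow (B 0 1 * x) 2 2, (by ring : (B 0 1 * 2 * (x : ℤ)) ^ 2 = 4 * (B 0 1 * x) ^ 2)]⟩
    rw [Int.even_pow' (by norm_num)] at hev
    have hxo : Odd x' := by rw [← hxz', Nat.odd_mul] at hmo; exact hmo.1
    exact (Nat.not_even_iff_odd.2 hxo) (by exact_mod_cast hev)

/-- For `m` odd, the double cosets `Γ₀(2)⁺·[[1,0],[0,m]]·Γ₀(2)`,
`Γ₀(2)⁺·[[m,0],[0,1]]·Γ₀(2)`, `Γ₀(2)⁺·[[m,0],[0,1]]·Γ₀(2)⁺` and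
`Γ₀(2)⁺·[[1,0],[0,m]]·Γ₀(2)⁺` all coincide, and equal the disjoint union of the
left cosets `Γ₀(2)⁺·γ` over `γ ∈ M^m` (all up to positive scalars, i.e. in
`PSL(2,ℝ)`). -/
theorem double_coset_decomposition_odd (m : ℕ) (hm : 0 < m) (hmo : Odd m) :
    (∀ A : M2R,
      ((∃ g₁ g₂ : M2R, IsGamma0TwoPlus g₁ ∧ IsGamma0Two g₂ ∧
          projEq A (g₁ * !![(1 : ℝ), 0; 0, (m : ℝ)] * g₂))
        ↔ (∃ g₁ g₂ : M2R, IsGamma0TwoPlus g₁ ∧ IsGamma0Two g₂ ∧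
          projEq A (g₁ * !![(m : ℝ), 0; 0, 1] * g₂)))
      ∧ ((∃ g₁ g₂ : M2R, IsGamma0TwoPlus g₁ ∧ IsGamma0Two g₂ ∧
          projEq A (g₁ * !![(m : ℝ), 0; 0, 1] * g₂))
        ↔ (∃ g₁ g₂ : M2R, IsGamma0TwoPlus g₁ ∧ IsGamma0TwoPlus g₂ ∧
          projEq A (g₁ * !![(m : ℝ), 0; 0, 1] * g₂)))
      ∧ ((∃ g₁ g₂ : M2R, IsGamma0TwoPlus g₁ ∧ IsGamma0TwoPlus g₂ ∧
          projEq A (g₁ * !![(m : ℝ), 0; 0, 1] * g₂))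
        ↔ (∃ g₁ g₂ : M2R, IsGamma0TwoPlus g₁ ∧ IsGamma0TwoPlus g₂ ∧
          projEq A (g₁ * !![(1 : ℝ), 0; 0, (m : ℝ)] * g₂)))
      ∧ ((∃ g₁ g₂ : M2R, IsGamma0TwoPlus g₁ ∧ IsGamma0TwoPlus g₂ ∧
          projEq A (g₁ * !![(1 : ℝ), 0; 0, (m : ℝ)] * g₂))
        ↔ ∃ γ ∈ MSetOdd m, ∃ g : M2R, IsGamma0TwoPlus g ∧ projEq A (g * γ)))
    ∧ ∀ γ ∈ MSetOdd m, ∀ γ' ∈ MSetOdd m,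
        (∃ g : M2R, IsGamma0TwoPlus g ∧ projEq γ' (g * γ)) → γ = γ' := by
  have GP : ∀ g, IsGamma0Two g → IsGamma0TwoPlus g := fun g h => Or.inl h
  refine ⟨fun A => ?_, fun γ hγ γ' hγ' h => disj hm hmo γ hγ γ' hγ' h⟩
  have a1 : (∃ g₁ g₂ : M2R, IsGamma0TwoPlus g₁ ∧ IsGamma0Two g₂ ∧
          projEq A (g₁ * !![(1 : ℝ), 0; 0, (m : ℝ)] * g₂)) ↔ TT m A := by
    constructor
    · rintro ⟨g₁, g₂, h₁, h₂, c, hc, rfl⟩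
      exact (((TT_D m).lP h₁).rP hmo (GP _ h₂)).smul hc
    · intro h
      obtain ⟨g, X, hg, ⟨g₂, hg₂, rfl⟩, hp⟩ := h.out
        (fun X => ∃ g₂, IsGamma0Two g₂ ∧ X = !![(1 : ℝ), 0; 0, (m : ℝ)] * g₂) (by
          intro N hN
          obtain ⟨B, C, hB, hC, rfl⟩ := smith hm hmo hN
          exact ⟨B, _, hB, ⟨ic C, (isG_iff _).2 ⟨C, hC, rfl⟩, rfl⟩, by
            rw [ic_mul, ic_mul, ic_lit, mul_assoc]; simp only [Int.cast_one, Int.cast_zero, Int.cast_natCast]⟩)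
      exact ⟨g, g₂, hg, hg₂, by rwa [mul_assoc]⟩
  have a2 : (∃ g₁ g₂ : M2R, IsGamma0TwoPlus g₁ ∧ IsGamma0Two g₂ ∧
          projEq A (g₁ * !![(m : ℝ), 0; 0, 1] * g₂)) ↔ TT m A := by
    constructor
    · rintro ⟨g₁, g₂, h₁, h₂, c, hc, rfl⟩
      exact (((TT_D' m).lP h₁).rP hmo (GP _ h₂)).smul hc
    · intro h
      obtain ⟨g, X, hg, ⟨g₂, hg₂, rfl⟩, hp⟩ := h.out
        (fun X => ∃ g₂, IsGamma0Two g₂ ∧ X = !![(m : ℝ), 0; 0, 1] * g₂) (by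
          intro N hN
          obtain ⟨B, C, hB, hC, rfl⟩ := smith' hm hmo hN
          exact ⟨B, _, hB, ⟨ic C, (isG_iff _).2 ⟨C, hC, rfl⟩, rfl⟩, by
            rw [ic_mul, ic_mul, ic_lit, mul_assoc]; simp only [Int.cast_one, Int.cast_zero, Int.cast_natCast]⟩)
      exact ⟨g, g₂, hg, hg₂, by rwa [mul_assoc]⟩
  have a3 : (∃ g₁ g₂ : M2R, IsGamma0TwoPlus g₁ ∧ IsGamma0TwoPlus g₂ ∧
          projEq A (g₁ * !![(m : ℝ), 0; 0, 1] * g₂)) ↔ TT m A := by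
    constructor
    · rintro ⟨g₁, g₂, h₁, h₂, c, hc, rfl⟩
      exact (((TT_D' m).lP h₁).rP hmo h₂).smul hc
    · intro h
      obtain ⟨g₁, g₂, h₁, h₂, h₃⟩ := a2.2 h
      exact ⟨g₁, g₂, h₁, GP _ h₂, h₃⟩
  have a4 : (∃ g₁ g₂ : M2R, IsGamma0TwoPlus g₁ ∧ IsGamma0TwoPlus g₂ ∧
          projEq A (g₁ * !![(1 : ℝ), 0; 0, (m : ℝ)] * g₂)) ↔ TT m A := by
    constructor
    · rintro ⟨g₁, g₂, h₁, h₂, c, hc, rfl⟩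
      exact (((TT_D m).lP h₁).rP hmo h₂).smul hc
    · intro h
      obtain ⟨g₁, g₂, h₁, h₂, h₃⟩ := a1.2 h
      exact ⟨g₁, g₂, h₁, GP _ h₂, h₃⟩
  have a5 : (∃ γ ∈ MSetOdd m, ∃ g : M2R, IsGamma0TwoPlus g ∧ projEq A (g * γ)) ↔ TT m A := by
    constructor
    · rintro ⟨γ, hγ, g, hg, c, hc, rfl⟩
      exact ((TT_M hγ).lP hg).smul hc
    · intro h
      obtain ⟨g, X, hg, hX, hp⟩ := h.out (fun X => X ∈ MSetOdd m) (by
          intro N hN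
          obtain ⟨B, hB, x, y, z, hxz, hyz, -, e⟩ := hermite hm hmo hN
          have hP : PrimZ m !![(x : ℤ), y; 0, z] := by
            have := hN.lmul hB.adj
            rwa [e, ← mul_assoc, hB.adj_mul, one_mul] at this
          exact ⟨B, _, hB, ⟨x, y, z, hxz, hyz, (prim_upper hxz).1 hP, rfl⟩, by
            rw [e]; simp [ic_mul, ic_lit]⟩)
      exact ⟨X, hX, g, hg, hp⟩
  exact ⟨a1.trans a2.symm, a2.trans a3.symm, a3.trans a4.symm, a4.trans a5.symm⟩
end
end
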